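/- arXiv:math/0508289 — 4 statements merged into one kernel-verified Lean document; each statement's English description precedes it below -/
import Mathlib

section
/- In the affine Hecke algebra H, for all non-negative integers m and k the following relation holds: R K^m R K^k − K^k R K^m R = ω · Σ_{i=1}^{k} ( K^{m+k−i} R K^i − K^i R K^{m+k−i} ). -/
noncomputable section
namespace Baxterization
open scoped TensorProduct

/-! ## The affine Hecke algebra of rank one -/

variable (k : Type) [Field k]
variable (z : Type) [CommRing z] [Algebra k z]

/-- the two generators R and K -/
inductive G : Type | R | K

/-- The defining relations of the affine Hecke algebra of rank one:
the Hecke condition `R² = ωR + 1` and the reflection equation `RKRK = KRKR`. -/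
inductive HRel (ω : z) : FreeAlgebra z G → FreeAlgebra z G → Prop
  | hecke : HRel ω (FreeAlgebra.ι z G.R * FreeAlgebra.ι z G.R)
      (ω • FreeAlgebra.ι z G.R + 1)
  | re : HRel ω (FreeAlgebra.ι z G.R * FreeAlgebra.ι z G.K * FreeAlgebra.ι z G.R *
        FreeAlgebra.ι z G.K)
      (FreeAlgebra.ι z G.K * FreeAlgebra.ι z G.R * FreeAlgebra.ι z G.K * FreeAlgebra.ι z G.R)

/-- The affine Hecke algebra of rank one over 𝔷, with parameter ω: the quotient of the
free algebra 𝔷⟨R,K⟩ by the ideal of relations `R² = ωR + 1` and `RKRK = KRKR`. -/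
def H (ω : z) : Type := RingQuot (HRel z ω)

variable (ω : z)

instance : Ring (H z ω) := inferInstanceAs (Ring (RingQuot (HRel z ω)))
instance : Algebra z (H z ω) := inferInstanceAs (Algebra z (RingQuot (HRel z ω)))
instance : Algebra k (H z ω) := inferInstanceAs (Algebra k (RingQuot (HRel z ω)))
instance : IsScalarTower k z (H z ω) :=
  inferInstanceAs (IsScalarTower k z (RingQuot (HRel z ω)))

/-- the generator R of the affine Hecke algebra -/
def Rg : H z ω := RingQuot.mkAlgHom z (HRel z ω) (FreeAlgebra.ι z G.R)
/-- the generator K of the affine Hecke algebra -/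
def Kg : H z ω := RingQuot.mkAlgHom z (HRel z ω) (FreeAlgebra.ι z G.K)
/-- Y = RKR -/
def Yg : H z ω := Rg z ω * Kg z ω * Rg z ω

/-- the elements e_{i;j} = KⁱRKʲ - KʲRKⁱ of the affine Hecke algebra -/
def eH (i j : ℕ) : H z ω :=
  Kg z ω ^ i * Rg z ω * Kg z ω ^ j - Kg z ω ^ j * Rg z ω * Kg z ω ^ i

/-! ## The cyclotomic Hecke algebra -/

/-- the element p(K) of H, where p(u) = -u^(n+1) + A₀ uⁿ + A₁ u^(n-1) + ⋯ + Aₙ -/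
def pKelt (n : ℕ) (A : ℕ → z) : H z ω :=
  - (Kg z ω) ^ (n + 1) + ∑ i ∈ Finset.range (n + 1), A i • (Kg z ω) ^ (n - i)

/-- relation generating the two-sided ideal (p(K)) of H -/
inductive CRel (n : ℕ) (A : ℕ → z) : H z ω → H z ω → Prop
  | mk : CRel n A (pKelt z ω n A) 0

/-- The cyclotomic Hecke algebra H_p: the quotient of the affine Hecke algebra H by the
two-sided ideal generated by p(K), where p(u) = -u^(n+1) + A₀ uⁿ + ⋯ + Aₙ. -/
def Hp (n : ℕ) (A : ℕ → z) : Type := RingQuot (CRel z ω n A)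

instance (n : ℕ) (A : ℕ → z) : Ring (Hp z ω n A) :=
  inferInstanceAs (Ring (RingQuot (CRel z ω n A)))
instance (n : ℕ) (A : ℕ → z) : Algebra z (Hp z ω n A) :=
  inferInstanceAs (Algebra z (RingQuot (CRel z ω n A)))
instance (n : ℕ) (A : ℕ → z) : Algebra k (Hp z ω n A) :=
  inferInstanceAs (Algebra k (RingQuot (CRel z ω n A)))
instance (n : ℕ) (A : ℕ → z) : IsScalarTower k z (Hp z ω n A) :=
  inferInstanceAs (IsScalarTower k z (RingQuot (CRel z ω n A)))

/-- the image of R in the cyclotomic Hecke algebra -/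
def Rp (n : ℕ) (A : ℕ → z) : Hp z ω n A :=
  RingQuot.mkAlgHom z (CRel z ω n A) (Rg z ω)
/-- the image of K in the cyclotomic Hecke algebra -/
def Kp (n : ℕ) (A : ℕ → z) : Hp z ω n A :=
  RingQuot.mkAlgHom z (CRel z ω n A) (Kg z ω)
/-- Y = RKR in the cyclotomic Hecke algebra -/
def Yp (n : ℕ) (A : ℕ → z) : Hp z ω n A := Rp z ω n A * Kp z ω n A * Rp z ω n A

/-- the elements e_{i;j} = KⁱRKʲ - KʲRKⁱ of the cyclotomic Hecke algebra -/
def eHp (n : ℕ) (A : ℕ → z) (i j : ℕ) : Hp z ω n A :=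
  Kp z ω n A ^ i * Rp z ω n A * Kp z ω n A ^ j -
    Kp z ω n A ^ j * Rp z ω n A * Kp z ω n A ^ i

/-- the element K̃ = Kⁿ - A₀K^(n-1) - ⋯ - A_(n-1) of the cyclotomic Hecke algebra -/
def Ktil (n : ℕ) (A : ℕ → z) : Hp z ω n A :=
  Kp z ω n A ^ n - ∑ i ∈ Finset.range n, A i • Kp z ω n A ^ (n - 1 - i)

/-! ## Rational functions in one and two variables, and the spectral reflection equation -/

/-- polynomials in two variables x, y over the base field -/
abbrev P2 := MvPolynomial (Fin 2) k
/-- the field k(x,y) of rational functions in the two variables x, y -/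
abbrev F2 := FractionRing (P2 k)

/-- auxiliary: the embedding k[X] → k(x,y), X ↦ i-th variable -/
def embP (i : Fin 2) : Polynomial k →ₐ[k] F2 k :=
  (IsScalarTower.toAlgHom k (P2 k) (F2 k)).comp (Polynomial.aeval (MvPolynomial.X i))

lemma embP_injective (i : Fin 2) : Function.Injective (embP k i) := by
  have h : ((MvPolynomial.aeval (R := k) (fun j => if j = i then Polynomial.X else 0)).comp
      (Polynomial.aeval (R := k) (MvPolynomial.X i : P2 k))) = AlgHom.id k (Polynomial k) := by
    apply Polynomial.algHom_ext; simp
  have hinj : Function.Injective (Polynomial.aeval (R := k) (MvPolynomial.X i : P2 k)) := by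
    intro a b hab
    have h2 := congrArg (MvPolynomial.aeval (R := k)
      (fun j : Fin 2 => if j = i then (Polynomial.X : Polynomial k) else 0)) hab
    have ha := congrFun (congrArg (fun (f : Polynomial k →ₐ[k] Polynomial k) =>
      (f : Polynomial k → Polynomial k)) h) a
    have hb := congrFun (congrArg (fun (f : Polynomial k →ₐ[k] Polynomial k) =>
      (f : Polynomial k → Polynomial k)) h) b
    simp only [AlgHom.coe_comp, Function.comp_apply, AlgHom.coe_id, id_eq] at ha hb
    rw [← ha, ← hb]; exact h2
  exact (IsFractionRing.injective (P2 k) (F2 k)).comp hinj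

/-- the embedding k(x) → k(x,y) sending the variable to the i-th of the two variables -/
def emb (i : Fin 2) : RatFunc k →ₐ[k] F2 k :=
  RatFunc.liftAlgHom (embP k i)
    (nonZeroDivisors_le_comap_nonZeroDivisors_of_injective _ (embP_injective k i))

/-- the first spectral variable x, as an element of k(x,y) -/
def xvar : F2 k := algebraMap (P2 k) (F2 k) (MvPolynomial.X 0)
/-- the second spectral variable y, as an element of k(x,y) -/
def yvar : F2 k := algebraMap (P2 k) (F2 k) (MvPolynomial.X 1)

variable {B : Type} [Ring B] [Algebra k B]

/-- substitution of the spectral variable x by the i-th of the two variables x, y: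
the map B(x) → B(x,y) induced by `emb i`. -/
def iota (i : Fin 2) : RatFunc k ⊗[k] B →ₐ[k] F2 k ⊗[k] B :=
  Algebra.TensorProduct.map (emb k i) (AlgHom.id k B)

/-- the baxterized R-matrix `R(t) = R - t⁻¹ R⁻¹` (note `R⁻¹ = R - ω` by the Hecke
condition), as an element of B(x,y). -/
def RxElt (ωk : k) (Relt : B) (t : F2 k) : F2 k ⊗[k] B :=
  (1 : F2 k) ⊗ₜ[k] Relt - t⁻¹ • ((1 : F2 k) ⊗ₜ[k] (Relt - algebraMap k B ωk))

/-- `c`, viewed as an element `K(x)` of `B(x)`, satisfies the reflection equation with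
spectral parameter:  `R(x/y) K(x) R(xy) K(y) = K(y) R(xy) K(x) R(x/y)` in B(x,y). -/
def IsSol (ωk : k) (Relt : B) (c : RatFunc k ⊗[k] B) : Prop :=
  RxElt k ωk Relt (xvar k / yvar k) * iota k 0 c * RxElt k ωk Relt (xvar k * yvar k) *
      iota k 1 c =
    iota k 1 c * RxElt k ωk Relt (xvar k * yvar k) * iota k 0 c *
      RxElt k ωk Relt (xvar k / yvar k)

variable [Algebra z B]

/-- `c` lies in `𝔷(x)·1`, i.e. `c` is a scalar element of `B(x)`
(an element with trivial B-component). -/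
def IsScalarElt (c : RatFunc k ⊗[k] B) : Prop :=
  c ∈ Submodule.span (RatFunc k)
    (Set.range fun a : z => (1 : RatFunc k) ⊗ₜ[k] (algebraMap z B a))

/-- the functions φ_i(ξ,x) (φ₀ = 1, φ_{i+1} = φ_i·ξx - A_i),
viewed as (central, scalar) elements of B(x). -/
def phiT (ξ : z) (A : ℕ → z) : ℕ → RatFunc k ⊗[k] B
  | 0 => 1
  | (i + 1) => phiT ξ A i * ((RatFunc.X : RatFunc k) ⊗ₜ[k] algebraMap z B ξ)
      - (1 : RatFunc k) ⊗ₜ[k] (algebraMap z B (A i))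

/-- the principal baxterized element
`K_p(ξ,ζ,x) = ∑_{i=0}^{n-1} φ_i(ξ,x) K^{n-i} + (ζ - x⁻¹ φ_n(ξ,x))/(x - x⁻¹)`,
as an element of 𝒦_p(x) ⊆ H_p(x). -/
def KxMain (n : ℕ) (A : ℕ → z) (ξ ζ : z) : RatFunc k ⊗[k] Hp z ω n A :=
  (∑ i ∈ Finset.range n,
      phiT k z (B := Hp z ω n A) ξ A i * ((1 : RatFunc k) ⊗ₜ[k] (Kp z ω n A) ^ (n - i))) +
    ((RatFunc.X - RatFunc.X⁻¹)⁻¹ : RatFunc k) •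
      ((1 : RatFunc k) ⊗ₜ[k] algebraMap z (Hp z ω n A) ζ -
        (RatFunc.X⁻¹ : RatFunc k) • phiT k z (B := Hp z ω n A) ξ A n)

/-- the scalar function ψ(ξ,ζ,x) = (-ξⁿx^{n+1} + ∑_{i=0}^{n-1} A_i ξ^{n-1-i} x^{n-i} + ζ)/(x-x⁻¹),
viewed as a (scalar) element of H_p(x). -/
def psiT (n : ℕ) (A : ℕ → z) (ξ ζ : z) : RatFunc k ⊗[k] Hp z ω n A :=
  ((RatFunc.X - RatFunc.X⁻¹)⁻¹ : RatFunc k) •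
    (((∑ i ∈ Finset.range n,
        (RatFunc.X ^ (n - i) : RatFunc k) ⊗ₜ[k]
          algebraMap z (Hp z ω n A) (A i * ξ ^ (n - 1 - i))) +
      (1 : RatFunc k) ⊗ₜ[k] algebraMap z (Hp z ω n A) ζ) -
      ((RatFunc.X ^ (n + 1) : RatFunc k) ⊗ₜ[k] algebraMap z (Hp z ω n A) (ξ ^ n)))

/-- An element of 𝒦_p(x) is a *principal* solution if n = 1, or if n > 1 and the
coefficient of K^(n-1) in its expansion over the basis {1, K, …, K^(n-1), K̃} of 𝒦_p,
where K̃ = Kⁿ - A₀K^(n-1) - ⋯ - A_(n-1), is non-zero. -/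
def IsPrincipal (n : ℕ) (A : ℕ → z) (c : RatFunc k ⊗[k] Hp z ω n A) : Prop :=
  n = 1 ∨ (1 < n ∧ ∃ f : ℕ → RatFunc k ⊗[k] Hp z ω n A,
    (∀ i, IsScalarElt k z (B := Hp z ω n A) (f i)) ∧
    c = (∑ i ∈ Finset.range n, f i * ((1 : RatFunc k) ⊗ₜ[k] (Kp z ω n A) ^ i)) +
        f n * ((1 : RatFunc k) ⊗ₜ[k] Ktil z ω n A) ∧
    f (n - 1) ≠ 0)

/-! ## Commutative auxiliaries: the polynomial p, the functions φ and the coefficients A⁽ᵐ⁾ -/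

/-- the polynomial p(u) = -u^(n+1) + A₀ uⁿ + ⋯ + Aₙ -/
def pPoly (n : ℕ) (A : ℕ → z) : Polynomial z :=
  - Polynomial.X ^ (n + 1) +
    ∑ i ∈ Finset.range (n + 1), Polynomial.C (A i) * Polynomial.X ^ (n - i)

/-- the polynomials φ_i(ξ,x) ∈ 𝔷[x]: φ₀ = 1, φ_{i+1} = φ_i·ξx - A_i -/
def phiP (A : ℕ → z) (ξ : z) : ℕ → Polynomial z
  | 0 => 1
  | (i + 1) => phiP A ξ i * (Polynomial.C ξ * Polynomial.X) - Polynomial.C (A i)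

/-- the monic polynomial u^(n+1) - A₀uⁿ - ⋯ - Aₙ (i.e. -p(u)) -/
def qPoly (n : ℕ) (A : ℕ → z) : Polynomial z :=
  Polynomial.X ^ (n + 1) -
    ∑ i ∈ Finset.range (n + 1), Polynomial.C (A i) * Polynomial.X ^ (n - i)

/-- the coefficients A⁽ᵐ⁾_i ∈ 𝔷 defined by uᵐ ≡ ∑_{i=0}^n A⁽ᵐ⁾_i u^{n-i}
modulo the monic polynomial u^(n+1) - A₀uⁿ - ⋯ - Aₙ -/
def Am (n : ℕ) (A : ℕ → z) (m i : ℕ) : z :=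
  ((Polynomial.X : Polynomial z) ^ m %ₘ qPoly z n A).coeff (n - i)

/-- polynomials in two variables over 𝔷 -/
abbrev ZP2 := MvPolynomial (Fin 2) z

/-- the embedding 𝔷[u] → 𝔷[x,y] sending u to the i-th variable -/
def evP (i : Fin 2) : Polynomial z →ₐ[z] ZP2 z := Polynomial.aeval (MvPolynomial.X i)

/-- The subalgebra 𝒦_p(x) of H_p(x): rational functions of x with values in the
subalgebra 𝒦_p ⊆ H_p generated by K (over 𝔷). -/
def KpX (n : ℕ) (A : ℕ → z) : Subalgebra (RatFunc k) (RatFunc k ⊗[k] Hp z ω n A) :=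
  Algebra.adjoin (RatFunc k)
    ({(1 : RatFunc k) ⊗ₜ[k] Kp z ω n A} ∪
      Set.range (fun a : z => (1 : RatFunc k) ⊗ₜ[k] algebraMap z (Hp z ω n A) a))


section Commutator

variable {S A : Type*} [CommRing S] [Ring A] [Algebra S A] {c : S} {r x : A}

theorem hecke_reflection_commutator (hr : r * r = c • r + 1)
    (hrx : r * x * r * x = x * r * x * r) (m : ℕ) :
    r * x ^ m * r * x - x * r * x ^ m * r = c • (x ^ m * r * x - x * r * x ^ m) := by
  have hyx : Commute (r * x * r) x := by
    simpa only [Commute, SemiconjBy, mul_assoc] using hrx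
  generalize hy : r * x * r = y at hyx
  have hry : r * y = c • y + x * r := by
    rw [← hy, ← mul_assoc, ← mul_assoc, hr]
    simp only [add_mul, smul_mul_assoc, one_mul]
  have hxr : x * r = r * y - c • y := by rw [hry]; abel
  induction m with
  | zero =>
    simp only [pow_zero, mul_one, one_mul, mul_assoc x r r, hr, add_mul, mul_add,
      smul_mul_assoc, mul_smul_comm, smul_sub]
    abel
  | succ m ih =>
    have hym : x ^ m * y = y * x ^ m := (hyx.pow_right m).eq.symm
    have hstep : r * x ^ (m + 1) * r =
        r * x ^ m * r * y - c • (c • (y * x ^ m) + x * r * x ^ m) := by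
      calc r * x ^ (m + 1) * r = r * x ^ m * (x * r) := by
            rw [pow_succ]; simp only [mul_assoc]
        _ = r * x ^ m * r * y - c • (r * (x ^ m * y)) := by
            rw [hxr]; simp only [mul_sub, mul_smul_comm, mul_assoc]
        _ = _ := by
            rw [hym, ← mul_assoc, hry]
            simp only [add_mul, smul_mul_assoc]
    have hcomm : y * x ^ m * x = x * (y * x ^ m) := by
      rw [mul_assoc, ← pow_succ, (hyx.pow_right (m + 1)).eq, pow_succ', mul_assoc, hym]
    have hleft : x ^ m * r * x * y = c • (x ^ m * y * x) + x ^ (m + 1) * r * x := by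
      rw [mul_assoc _ x y, ← hyx.eq, ← mul_assoc, mul_assoc _ r y, hry, pow_succ]
      simp only [mul_add, add_mul, mul_smul_comm, smul_mul_assoc, mul_assoc]
    have hright : x * r * x ^ m * y = c • (x * (y * x ^ m)) + x * (x * r * x ^ m) := by
      rw [mul_assoc _ _ y, hym, ← mul_assoc, mul_assoc x r y, hry]
      simp only [mul_add, add_mul, mul_smul_comm, smul_mul_assoc, mul_assoc]
    have hih : r * x ^ m * r * y * x - x * (r * x ^ m * r * y) =
        c • (x ^ (m + 1) * r * x - x * (x * r * x ^ m)) := by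
      calc _ = (r * x ^ m * r * x - x * r * x ^ m * r) * y := by
            simp only [sub_mul, mul_assoc, hyx.eq]
        _ = c • (x ^ m * r * x * y - x * r * x ^ m * y) := by
            rw [ih, smul_mul_assoc, sub_mul]
        _ = _ := by
            rw [hleft, hright, hym, hcomm]; congr 1; abel
    calc _ = r * x ^ (m + 1) * r * x - x * (r * x ^ (m + 1) * r) := by
            simp only [mul_assoc]
      _ = (r * x ^ m * r * y * x - x * (r * x ^ m * r * y)) -
            c • (c • (y * x ^ m * x - x * (y * x ^ m)) +
              (x * r * x ^ m * x - x * (x * r * x ^ m))) := by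
          rw [hstep]
          simp only [sub_mul, mul_sub, add_mul, mul_add, smul_mul_assoc, mul_smul_comm,
            smul_add, smul_sub]
          abel
      _ = _ := by
          rw [hih, hcomm, sub_self, smul_zero, zero_add, ← smul_sub, mul_assoc _ (x ^ m) x,
            ← pow_succ]
          congr 1; abel

theorem hecke_reflection_commutator_pow (hr : r * r = c • r + 1)
    (hrx : r * x * r * x = x * r * x * r) (m n : ℕ) :
    r * x ^ m * r * x ^ n - x ^ n * r * x ^ m * r =
      c • ∑ i ∈ Finset.Icc 1 n,
        (x ^ (m + n - i) * r * x ^ i - x ^ i * r * x ^ (m + n - i)) := by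
  induction n with
  | zero => simp [mul_assoc]
  | succ n ih =>
    have hsum : ∑ i ∈ Finset.Icc 1 (n + 1),
          (x ^ (m + (n + 1) - i) * r * x ^ i - x ^ i * r * x ^ (m + (n + 1) - i)) =
        (∑ i ∈ Finset.Icc 1 n,
          (x ^ (m + n - i) * r * x ^ i - x ^ i * r * x ^ (m + n - i))) * x +
        x ^ n * (x ^ m * r * x - x * r * x ^ m) := by
      have hfst : ∑ i ∈ Finset.Icc 1 (n + 1), x ^ (m + (n + 1) - i) * r * x ^ i =
          (∑ i ∈ Finset.Icc 1 n, x ^ (m + n - i) * r * x ^ i) * x +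
            x ^ n * (x ^ m * r * x) := by
        have hshift : ∑ i ∈ Finset.Icc 1 n, x ^ (m + n - i) * r * x ^ (i + 1) =
            ∑ i ∈ Finset.Ioc 1 (n + 1), x ^ (m + (n + 1) - i) * r * x ^ i := by
          refine Finset.sum_bij (fun i _ => i + 1) ?_ ?_ ?_ ?_
          · simp only [Finset.mem_Icc, Finset.mem_Ioc]; omega
          · simp
          · intro j hj
            rw [Finset.mem_Ioc] at hj
            exact ⟨j - 1, Finset.mem_Icc.mpr (by omega), by omega⟩
          · intro i _
            rw [show m + (n + 1) - (i + 1) = m + n - i by omega]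
        rw [← Finset.sum_Ioc_add_eq_sum_Icc (by omega), ← hshift, Finset.sum_mul]
        simp only [pow_succ, pow_zero, one_mul, mul_assoc]
        rw [show m + (n + 1) - 1 = n + m by omega, pow_add]
        simp only [mul_assoc]
      have hsnd : ∑ i ∈ Finset.Icc 1 (n + 1), x ^ i * r * x ^ (m + (n + 1) - i) =
          (∑ i ∈ Finset.Icc 1 n, x ^ i * r * x ^ (m + n - i)) * x +
            x ^ n * (x * r * x ^ m) := by
        rw [Finset.sum_Icc_succ_top (by omega), Finset.sum_mul]
        congr 1
        · refine Finset.sum_congr rfl fun i hi => ?_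
          have := (Finset.mem_Icc.mp hi).2
          rw [mul_assoc, mul_assoc, mul_assoc, ← pow_succ]
          congr 3; omega
        · rw [show m + (n + 1) - (n + 1) = m by omega, pow_succ]
          simp only [mul_assoc]
      rw [Finset.sum_sub_distrib, hfst, hsnd, Finset.sum_sub_distrib, sub_mul, mul_sub]
      abel
    rw [hsum, smul_add, ← smul_mul_assoc, ← ih, ← mul_smul_comm,
      ← hecke_reflection_commutator hr hrx, pow_succ]
    simp only [sub_mul, mul_sub, mul_assoc]
    abel

end Commutator

theorem Rg_mul_Rg : Rg z ω * Rg z ω = ω • Rg z ω + 1 := by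
  have h := RingQuot.mkAlgHom_rel z (HRel.hecke (ω := ω))
  simp only [map_mul, map_add, map_smul, map_one] at h
  exact h

theorem Rg_Kg_reflection :
    Rg z ω * Kg z ω * Rg z ω * Kg z ω = Kg z ω * Rg z ω * Kg z ω * Rg z ω := by
  have h := RingQuot.mkAlgHom_rel z (HRel.re (ω := ω))
  simp only [map_mul] at h
  exact h

/-- In the affine Hecke algebra H, for all non-negative integers m and k:
R Kᵐ R Kᵏ − Kᵏ R Kᵐ R = ω · Σ_{i=1}^{k} ( K^{m+k−i} R Kⁱ − Kⁱ R K^{m+k−i} ). -/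
theorem commutation_relation_in_affine_Hecke_algebra [CharZero k]
    (q : k) (hq0 : q ≠ 0) (hq1 : q ≠ 1) (hq1' : q ≠ -1)
    (hω : ω = algebraMap k z (q - q⁻¹)) (m kk : ℕ) :
    Rg z ω * Kg z ω ^ m * Rg z ω * Kg z ω ^ kk -
        Kg z ω ^ kk * Rg z ω * Kg z ω ^ m * Rg z ω =
      ω • ∑ i ∈ Finset.Icc 1 kk,
        (Kg z ω ^ (m + kk - i) * Rg z ω * Kg z ω ^ i -
          Kg z ω ^ i * Rg z ω * Kg z ω ^ (m + kk - i)) := by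
  exact hecke_reflection_commutator_pow (Rg_mul_Rg z ω) (Rg_Kg_reflection z ω) m kk

end Baxterization
end
end

section
/- Let H̄ denote the quotient of the polynomial algebra H[K̄] by the two-sided ideal generated by K̄K − 1 and KK̄ − 1 (so K becomes invertible with inverse K̄). Then in H̄, for every integer m and every non-negative integer k: R K^m R K^{−k} − K^{−k} R K^m R = ω · Σ_{i=1}^{k} ( K^{i−k} R K^{m−i} − K^{m−i} R K^{i−k} ). -/
noncomputable section
namespace Baxterization
open scoped TensorProduct

/-! ## The affine Hecke algebra of rank one -/

variable (k : Type) [Field k]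
variable (z : Type) [CommRing z] [Algebra k z]

variable (ω : z)

variable {B : Type} [Ring B] [Algebra k B]

variable [Algebra z B]

/-- the three generators R, K, K̄ -/
inductive G3 : Type | R | K | Kb

/-- The defining relations of H̄: the relations of the affine Hecke algebra H together with
K̄K = KK̄ = 1, so that H̄ is the quotient of the algebra H[K̄] obtained from H by adjoining
the new generator K̄ by the two-sided ideal generated by K̄K − 1 and KK̄ − 1. -/
inductive BRel (ω : z) : FreeAlgebra z G3 → FreeAlgebra z G3 → Prop
  | hecke : BRel ω (FreeAlgebra.ι z G3.R * FreeAlgebra.ι z G3.R)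
      (ω • FreeAlgebra.ι z G3.R + 1)
  | re : BRel ω (FreeAlgebra.ι z G3.R * FreeAlgebra.ι z G3.K * FreeAlgebra.ι z G3.R *
        FreeAlgebra.ι z G3.K)
      (FreeAlgebra.ι z G3.K * FreeAlgebra.ι z G3.R * FreeAlgebra.ι z G3.K *
        FreeAlgebra.ι z G3.R)
  | inv1 : BRel ω (FreeAlgebra.ι z G3.K * FreeAlgebra.ι z G3.Kb) 1
  | inv2 : BRel ω (FreeAlgebra.ι z G3.Kb * FreeAlgebra.ι z G3.K) 1

/-- H̄: the affine Hecke algebra with the generator K inverted. -/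
def Hb : Type := RingQuot (BRel z ω)

instance : Ring (Hb z ω) := inferInstanceAs (Ring (RingQuot (BRel z ω)))
instance : Algebra z (Hb z ω) := inferInstanceAs (Algebra z (RingQuot (BRel z ω)))

/-- the generator R of H̄ -/
def Rb : Hb z ω := RingQuot.mkAlgHom z (BRel z ω) (FreeAlgebra.ι z G3.R)
/-- the generator K of H̄ -/
def Kb : Hb z ω := RingQuot.mkAlgHom z (BRel z ω) (FreeAlgebra.ι z G3.K)
/-- the generator K̄ = K⁻¹ of H̄ -/
def Kbi : Hb z ω := RingQuot.mkAlgHom z (BRel z ω) (FreeAlgebra.ι z G3.Kb)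

/-- integer powers of K in H̄ (negative powers are powers of K̄ = K⁻¹) -/
def Kzpow (m : ℤ) : Hb z ω := if 0 ≤ m then Kb z ω ^ m.toNat else Kbi z ω ^ (-m).toNat

section ReflectionEquation

variable {z} {ω} {A : Type} [Ring A] [Algebra z A] {r : A} {K : Aˣ}

/-- The difference of `[r Kᵐ r, K⁻¹]` and `ω (r K^(m-1) - K^(m-1) r)`. -/
def commDefect (ω : z) (r : A) (K : Aˣ) (m : ℤ) : A :=
  r * ↑(K ^ m) * r * ↑K⁻¹ - ↑K⁻¹ * (r * ↑(K ^ m) * r) -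
    ω • (r * ↑(K ^ (m - 1)) - ↑(K ^ (m - 1)) * r)

lemma commute_zpow_of_reflection (re : r * K * r * K = K * r * K * r) (m : ℤ) :
    ↑(K ^ m) * (r * K * r) = r * K * r * ↑(K ^ m) := by
  have h : Commute (r * K * r) (K : A) := by
    simpa [Commute, SemiconjBy, mul_assoc] using re
  exact (h.units_zpow_right m).eq.symm

lemma commDefect_succ (hecke : r * r = ω • r + 1) (re : r * K * r * K = K * r * K * r) (m : ℤ) :
    commDefect ω r K (m + 1) = commDefect ω r K m * (r * K * r) := by
  have hY := commute_zpow_of_reflection re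
  have hY' : ↑K⁻¹ * (r * K * r) = r * K * r * ↑K⁻¹ := by simpa using hY (-1)
  have hrY : r * (r * K * r) = ω • (r * K * r) + K * r := by
    rw [← mul_assoc, ← mul_assoc, hecke]
    simp only [add_mul, smul_mul_assoc, one_mul]
  have hm : (↑(K ^ (m - 1)) : A) * K = ↑(K ^ m) := by
    rw [← Units.val_mul, ← zpow_add_one, sub_add_cancel]
  have hm1 : (↑(K ^ m) : A) * ↑K⁻¹ = ↑(K ^ (m - 1)) := by
    rw [← Units.val_mul, ← zpow_sub_one]
  have hm2 : (↑K⁻¹ : A) * ↑(K ^ m) = ↑(K ^ (m - 1)) := by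
    rw [← Units.val_mul, ← zpow_neg_one, ← zpow_add, neg_add_eq_sub]
  have h1 : r * ↑(K ^ (m + 1)) * r
      = r * ↑(K ^ m) * r * (r * K * r) - ω • (r * ↑(K ^ m) * (r * K * r)) := by
    rw [mul_assoc (r * ↑(K ^ m)) r, hrY, mul_add, mul_smul_comm, add_sub_cancel_left,
      zpow_add_one, Units.val_mul]
    simp only [mul_assoc]
  have h2 : r * ↑(K ^ m) * (r * K * r) * ↑K⁻¹ = r * ↑(K ^ (m - 1)) * (r * K * r) := by
    rw [mul_assoc _ (r * K * r), ← hY', ← hm1]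
    simp only [mul_assoc]
  have h3 : ↑K⁻¹ * (r * ↑(K ^ m) * (r * K * r))
      = ω • (r * K * r * ↑(K ^ (m - 1))) + r * ↑(K ^ m) := by
    rw [mul_assoc r, hY, ← mul_assoc r, hrY, add_mul, mul_add, smul_mul_assoc, mul_smul_comm,
      ← mul_assoc _ (r * K * r), hY', mul_assoc (r * K * r), hm2, mul_assoc (K : A),
      Units.inv_mul_cancel_left]
  have h4 : ↑(K ^ (m - 1)) * r * (r * K * r)
      = ω • (r * K * r * ↑(K ^ (m - 1))) + ↑(K ^ m) * r := by
    rw [mul_assoc, hrY, mul_add, mul_smul_comm, hY, ← mul_assoc, hm]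
  have h5 : r * ↑(K ^ m) * r * (r * K * r) * ↑K⁻¹
      = r * ↑(K ^ m) * r * ↑K⁻¹ * (r * K * r) := by
    rw [mul_assoc _ (r * K * r), ← hY', mul_assoc _ (↑K⁻¹ : A)]
  unfold commDefect
  rw [add_sub_cancel_right, h1]
  simp only [sub_mul, mul_sub, smul_mul_assoc, mul_smul_comm]
  rw [h2, h3, h4, h5, mul_assoc (↑K⁻¹ : A)]
  module

lemma isUnit_of_hecke (hecke : r * r = ω • r + 1) : IsUnit r := by
  refine ⟨⟨r, r - ω • 1, ?_, ?_⟩, rfl⟩ <;> simp [mul_sub, sub_mul, hecke]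

lemma commDefect_eq_zero (hecke : r * r = ω • r + 1) (re : r * K * r * K = K * r * K * r)
    (m : ℤ) : commDefect ω r K m = 0 := by
  have hr := isUnit_of_hecke hecke
  have hY : IsUnit (r * K * r) := (hr.mul K.isUnit).mul hr
  induction m using Int.induction_on with
  | zero => simp [commDefect, hecke, add_mul, mul_add, smul_sub]
  | succ n ih => rw [commDefect_succ hecke re, ih, zero_mul]
  | pred n ih =>
    have h := commDefect_succ hecke re (-(n : ℤ) - 1)
    rw [sub_add_cancel, ih] at h
    exact hY.mul_left_eq_zero.mp h.symm

lemma commutator_zpow_neg (hecke : r * r = ω • r + 1) (re : r * K * r * K = K * r * K * r)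
    (m : ℤ) (n : ℕ) :
    r * ↑(K ^ m) * r * ↑(K ^ (-(n : ℤ))) - ↑(K ^ (-(n : ℤ))) * (r * ↑(K ^ m) * r) =
      ω • (∑ i ∈ Finset.range n, ↑(K ^ ((i : ℤ) + 1 - n)) * r * ↑(K ^ (m - (i + 1))) -
        ∑ i ∈ Finset.range n, ↑(K ^ (m - ((i : ℤ) + 1))) * r * ↑(K ^ ((i : ℤ) + 1 - n))) := by
  induction n with
  | zero => simp
  | succ n ih =>
    have hD := sub_eq_zero.mp (commDefect_eq_zero hecke re m)
    have hK : (↑(K ^ (-((n + 1 : ℕ) : ℤ))) : A) = ↑(K ^ (-(n : ℤ))) * ↑K⁻¹ := by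
      rw [← Units.val_mul, ← zpow_sub_one]; congr 2; push_cast; ring
    have hsplit : r * ↑(K ^ m) * r * (↑(K ^ (-(n : ℤ))) * ↑K⁻¹) -
          ↑(K ^ (-(n : ℤ))) * ↑K⁻¹ * (r * ↑(K ^ m) * r) =
        (r * ↑(K ^ m) * r * ↑(K ^ (-(n : ℤ))) - ↑(K ^ (-(n : ℤ))) * (r * ↑(K ^ m) * r)) * ↑K⁻¹ +
        ↑(K ^ (-(n : ℤ))) * (r * ↑(K ^ m) * r * ↑K⁻¹ - ↑K⁻¹ * (r * ↑(K ^ m) * r)) := by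
      noncomm_ring
    have hl : ∀ j : ℤ, (↑(K ^ j) : A) * ↑K⁻¹ = ↑(K ^ (j - 1)) := fun j => by
      rw [← Units.val_mul, ← zpow_sub_one]
    have hlast : (↑(K ^ (-(n : ℤ))) : A) * (↑(K ^ (m - 1)) * r) = ↑(K ^ (m - (n + 1))) * r := by
      rw [← mul_assoc, ← Units.val_mul, ← zpow_add]; congr 3; ring
    rw [hK, hsplit, ih, hD, Finset.sum_range_succ', Finset.sum_range_succ, smul_mul_assoc,
      mul_smul_comm, ← smul_add, sub_mul, Finset.sum_mul, Finset.sum_mul, mul_sub, hlast]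
    have e1 : ∀ i : ℕ, (↑(K ^ ((i : ℤ) + 1 - n)) : A) * r * ↑(K ^ (m - (i + 1))) * ↑K⁻¹ =
        ↑(K ^ (((i + 1 : ℕ) : ℤ) + 1 - (n + 1 : ℕ))) * r * ↑(K ^ (m - ((i + 1 : ℕ) + 1))) := by
      intro i
      rw [mul_assoc _ _ (↑K⁻¹ : A), hl]
      have h1 : ((i + 1 : ℕ) : ℤ) + 1 - (n + 1 : ℕ) = i + 1 - n := by push_cast; ring
      have h2 : m - (((i + 1 : ℕ) : ℤ) + 1) = m - (i + 1) - 1 := by push_cast; ring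
      rw [h1, h2]
    have e2 : ∀ i : ℕ, (↑(K ^ (m - ((i : ℤ) + 1))) : A) * r * ↑(K ^ ((i : ℤ) + 1 - n)) * ↑K⁻¹ =
        ↑(K ^ (m - ((i : ℤ) + 1))) * r * ↑(K ^ ((i : ℤ) + 1 - (n + 1 : ℕ))) := by
      intro i
      rw [mul_assoc _ _ (↑K⁻¹ : A), hl]
      congr 3; push_cast; ring
    simp only [e1, e2]
    have e3 : ((0 : ℕ) : ℤ) + 1 - (n + 1 : ℕ) = -n := by push_cast; ring
    have e4 : (n : ℤ) + 1 - (n + 1 : ℕ) = 0 := by push_cast; ring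
    rw [e3, e4, zpow_zero, Units.val_one, mul_one, Nat.cast_zero, zero_add, ← mul_assoc]
    congr 1
    abel

end ReflectionEquation

lemma Kb_mul_Kbi : Kb z ω * Kbi z ω = 1 := by
  have h := RingQuot.mkAlgHom_rel z (BRel.inv1 (z := z) (ω := ω))
  rw [map_mul, map_one] at h
  exact h

lemma Kbi_mul_Kb : Kbi z ω * Kb z ω = 1 := by
  have h := RingQuot.mkAlgHom_rel z (BRel.inv2 (z := z) (ω := ω))
  rw [map_mul, map_one] at h
  exact h

lemma Rb_mul_Rb : Rb z ω * Rb z ω = ω • Rb z ω + 1 := by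
  have h := RingQuot.mkAlgHom_rel z (BRel.hecke (z := z) (ω := ω))
  rw [map_mul, map_add, map_smul, map_one] at h
  exact h

lemma Rb_Kb_reflection :
    Rb z ω * Kb z ω * Rb z ω * Kb z ω = Kb z ω * Rb z ω * Kb z ω * Rb z ω := by
  have h := RingQuot.mkAlgHom_rel z (BRel.re (z := z) (ω := ω))
  simp only [map_mul] at h
  exact h

/-- `K` as a unit of `H̄`. -/
def KbUnit : (Hb z ω)ˣ := ⟨Kb z ω, Kbi z ω, Kb_mul_Kbi z ω, Kbi_mul_Kb z ω⟩

lemma Kzpow_eq_zpow (m : ℤ) : Kzpow z ω m = ↑(KbUnit z ω ^ m) := by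
  unfold Kzpow
  split_ifs with h
  · obtain ⟨n, rfl⟩ := Int.eq_ofNat_of_zero_le h
    simp [KbUnit]
  · obtain ⟨n, hn⟩ := Int.eq_ofNat_of_zero_le (by omega : 0 ≤ -m)
    obtain rfl : m = -n := by omega
    rw [zpow_neg, zpow_natCast, ← inv_pow]
    simp [KbUnit]

/-- In H̄, for every integer m and every non-negative integer k:
R Kᵐ R K^{−k} − K^{−k} R Kᵐ R = ω · Σ_{i=1}^{k} ( K^{i−k} R K^{m−i} − K^{m−i} R K^{i−k} ). -/
theorem commutation_relation_in_localized_affine_Hecke_algebra [CharZero k]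
    (q : k) (hq0 : q ≠ 0) (hq1 : q ≠ 1) (hq1' : q ≠ -1)
    (hω : ω = algebraMap k z (q - q⁻¹)) (m : ℤ) (kk : ℕ) :
    Rb z ω * Kzpow z ω m * Rb z ω * Kzpow z ω (-(kk : ℤ)) -
        Kzpow z ω (-(kk : ℤ)) * Rb z ω * Kzpow z ω m * Rb z ω =
      ω • ∑ i ∈ Finset.Icc 1 kk,
        (Kzpow z ω ((i : ℤ) - (kk : ℤ)) * Rb z ω * Kzpow z ω (m - (i : ℤ)) -
          Kzpow z ω (m - (i : ℤ)) * Rb z ω * Kzpow z ω ((i : ℤ) - (kk : ℤ))) := by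
  have h := commutator_zpow_neg (K := KbUnit z ω) (Rb_mul_Rb z ω) (Rb_Kb_reflection z ω) m kk
  rw [← Finset.sum_sub_distrib] at h
  rw [← Finset.Ico_add_one_right_eq_Icc, Finset.sum_Ico_eq_sum_range]
  simp only [Kzpow_eq_zpow, Nat.add_sub_cancel, Nat.cast_add, Nat.cast_one, add_comm (1 : ℤ)]
  simpa only [mul_assoc] using h

end Baxterization
end
end

section
/- The elements e_{i;j} := K^i R K^j − K^j R K^i of the affine Hecke algebra H, for i > j ≥ 0, are linearly independent over 𝔷; consequently they form a basis of the 𝔷-submodule L ⊆ H spanned by all e_{i;j}, i, j ≥ 0. -/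
noncomputable section
namespace Baxterization
open scoped TensorProduct

/-! ## The affine Hecke algebra of rank one -/

variable (k : Type) [Field k]
variable (z : Type) [CommRing z] [Algebra k z]

variable (ω : z)

variable {B : Type} [Ring B] [Algebra k B]

variable [Algebra z B]

/-! ## A representation by 2×2 matrices over 𝔷[x,y]

Left multiplication on `H`, in the basis `1, R` of `H` as a right module over the commutative
subalgebra `𝔷[K, Y]`, gives 2×2 matrices over the polynomial ring in `x` (for `K`)
and `y` (for `Y`). Here `x` is `C X` and `y` is `X`. -/

open Polynomial in
/-- The matrix of left multiplication by `K` in the basis `1, R`. -/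
def matK : Matrix (Fin 2) (Fin 2) (Polynomial (Polynomial z)) :=
  !![C X, -(C (C ω) * X); 0, X]

open Polynomial in
/-- The matrix of left multiplication by `R` in the basis `1, R`. -/
def matR : Matrix (Fin 2) (Fin 2) (Polynomial (Polynomial z)) :=
  !![0, 1; 1, C (C ω)]

lemma matR_mul_self : matR z ω * matR z ω = ω • matR z ω + 1 := by
  ext i j : 1
  fin_cases i <;> fin_cases j <;>
    simp [matR, Algebra.smul_def (A := Polynomial (Polynomial z)),
      Polynomial.algebraMap_apply, add_comm]

lemma matR_matK_reflection :
    matR z ω * matK z ω * matR z ω * matK z ω = matK z ω * matR z ω * matK z ω * matR z ω := by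
  simp only [matR, matK, Matrix.mul_fin_two]
  ext i j : 1
  fin_cases i <;> fin_cases j <;> simp <;> ring

/-- The representation of the affine Hecke algebra by 2×2 matrices over 𝔷[x,y]. -/
def matRep : H z ω →ₐ[z] Matrix (Fin 2) (Fin 2) (Polynomial (Polynomial z)) :=
  RingQuot.liftAlgHom z ⟨FreeAlgebra.lift z (fun | G.R => matR z ω | G.K => matK z ω), by
    rintro _ _ (_ | _)
    · simpa using matR_mul_self z ω
    · simpa using matR_matK_reflection z ω⟩

lemma matRep_Rg : matRep z ω (Rg z ω) = matR z ω := by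
  unfold matRep Rg
  exact (RingQuot.liftAlgHom_mkAlgHom_apply z _ _ _).trans (FreeAlgebra.lift_ι_apply _ _)

lemma matRep_Kg : matRep z ω (Kg z ω) = matK z ω := by
  unfold matRep Kg
  exact (RingQuot.liftAlgHom_mkAlgHom_apply z _ _ _).trans (FreeAlgebra.lift_ι_apply _ _)

open Polynomial in
lemma matK_pow_apply (n : ℕ) :
    (matK z ω ^ n) 0 0 = C X ^ n ∧ (matK z ω ^ n) 1 0 = 0 ∧ (matK z ω ^ n) 1 1 = X ^ n := by
  induction n with
  | zero => simp
  | succ n ih =>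
    obtain ⟨h00, h10, h11⟩ := ih
    simp only [pow_succ, Matrix.mul_apply, Fin.sum_univ_two, h00, h10, h11]
    simp [matK]

open Polynomial in
lemma matRep_eH_apply (i j : ℕ) :
    matRep z ω (eH z ω i j) 1 0 = C X ^ j * X ^ i - C X ^ i * X ^ j := by
  obtain ⟨hi00, hi10, hi11⟩ := matK_pow_apply z ω i
  obtain ⟨hj00, hj10, hj11⟩ := matK_pow_apply z ω j
  simp only [eH, map_sub, map_mul, map_pow, matRep_Rg, matRep_Kg]
  simp [Matrix.mul_apply, Fin.sum_univ_two, hi00, hi10, hi11, hj00, hj10, hj11, matR]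
  ring

/-- The coefficient of `xʲyⁱ` in the lower left entry of the matrix of `eH z ω a b`. -/
lemma coeff_matRep_eH (i j a b : ℕ) :
    ((matRep z ω (eH z ω a b) 1 0).coeff i).coeff j =
      (if i = a ∧ j = b then 1 else 0) - (if i = b ∧ j = a then 1 else 0) := by
  rw [matRep_eH_apply, ← Polynomial.C_pow, ← Polynomial.C_pow]
  simp only [Polynomial.coeff_sub, Polynomial.coeff_C_mul, Polynomial.coeff_X_pow]
  congr 1 <;> split_ifs <;> simp_all [Polynomial.coeff_X_pow]

lemma linearIndependent_eH :
    LinearIndependent z (fun p : {p : ℕ × ℕ // p.2 < p.1} => eH z ω p.1.1 p.1.2) := by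
  rw [linearIndependent_iff']
  rintro s c hc ⟨⟨i, j⟩, hij⟩ hp
  have h := congrArg (fun v => ((matRep z ω v 1 0).coeff i).coeff j) hc
  simp only [map_sum, map_smul, map_zero, Matrix.sum_apply, Matrix.smul_apply,
    Polynomial.finsetSum_coeff, Polynomial.coeff_smul, coeff_matRep_eH, Matrix.zero_apply,
    Polynomial.coeff_zero] at h
  rw [Finset.sum_eq_single_of_mem _ hp] at h
  · have : ¬ (i = j ∧ j = i) := by simp only at hij; omega
    simpa [this] using h
  · rintro ⟨⟨a, b⟩, hab⟩ - hne
    simp only at hij hab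
    have h1 : ¬ (i = a ∧ j = b) := by rintro ⟨rfl, rfl⟩; exact hne rfl
    have h2 : ¬ (i = b ∧ j = a) := by omega
    simp [h1, h2]

lemma eH_swap (i j : ℕ) : eH z ω j i = -eH z ω i j := by simp [eH]

lemma span_eH :
    Submodule.span z
        (Set.range (fun p : {p : ℕ × ℕ // p.2 < p.1} => eH z ω p.1.1 p.1.2)) =
      Submodule.span z {v : H z ω | ∃ i j : ℕ, v = eH z ω i j} := by
  apply le_antisymm
  · apply Submodule.span_mono
    rintro _ ⟨p, rfl⟩
    exact ⟨_, _, rfl⟩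
  · rw [Submodule.span_le]
    rintro _ ⟨i, j, rfl⟩
    rcases lt_trichotomy i j with h | rfl | h
    · rw [eH_swap z ω j i]
      exact Submodule.neg_mem _ (Submodule.subset_span ⟨⟨(j, i), h⟩, rfl⟩)
    · simp [eH]
    · exact Submodule.subset_span ⟨⟨(i, j), h⟩, rfl⟩

/-- The elements e_{i;j} = KⁱRKʲ − KʲRKⁱ, i > j ≥ 0, of the affine Hecke
algebra are linearly independent over 𝔷; consequently they form a basis of the 𝔷-submodule
L ⊆ H spanned by all the e_{i;j}, i, j ≥ 0. -/
theorem eH_linearIndependent_and_span [CharZero k]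
    (q : k) (hq0 : q ≠ 0) (hq1 : q ≠ 1) (hq1' : q ≠ -1)
    (hω : ω = algebraMap k z (q - q⁻¹)) :
    LinearIndependent z (fun p : {p : ℕ × ℕ // p.2 < p.1} => eH z ω p.1.1 p.1.2) ∧
      Submodule.span z
          (Set.range (fun p : {p : ℕ × ℕ // p.2 < p.1} => eH z ω p.1.1 p.1.2)) =
        Submodule.span z {v : H z ω | ∃ i j : ℕ, v = eH z ω i j} := by
  exact ⟨linearIndependent_eH z ω, span_eH z ω⟩

end Baxterization
end
end

section
/- Let n = 1 and p(u) = −u² + A_0 u + A_1 with A_0, A_1 ∈ 𝔷, so that K² = A_0 K + A_1 in 𝒦_p. Then for arbitrary ζ, ξ ∈ 𝔷 the element K(x) := K + (ζ − x⁻¹(ξx − A_0))/(x − x⁻¹) of 𝒦_p(x) is a solution of the reflection equation with spectral parameter. Moreover, if 𝔷 is a field, then every non-trivial solution K(x) ∈ 𝒦_p(x) equals f(x)·(K + (ζ − x⁻¹(ξx − A_0))/(x − x⁻¹)) for some f ∈ 𝔷(x) and some ζ, ξ ∈ 𝔷. -/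
noncomputable section
namespace Baxterization
open scoped TensorProduct

/-! ## The affine Hecke algebra of rank one -/

variable (k : Type) [Field k]
variable (z : Type) [CommRing z] [Algebra k z]

variable (ω : z)

variable {B : Type} [Ring B] [Algebra k B]

variable [Algebra z B]

/-- the baxterized element K(x) = K + (ζ − x⁻¹(ξx − A₀))/(x − x⁻¹) for the quadratic case -/
def Kquad (A : ℕ → z) (zeta xi : z) : RatFunc k ⊗[k] Hp z ω 1 A :=
  (1 : RatFunc k) ⊗ₜ[k] Kp z ω 1 A +
    ((RatFunc.X - RatFunc.X⁻¹)⁻¹ : RatFunc k) •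
      ((1 : RatFunc k) ⊗ₜ[k] algebraMap z (Hp z ω 1 A) zeta -
        (RatFunc.X⁻¹ : RatFunc k) •
          ((RatFunc.X : RatFunc k) ⊗ₜ[k] algebraMap z (Hp z ω 1 A) xi -
            (1 : RatFunc k) ⊗ₜ[k] algebraMap z (Hp z ω 1 A) (A 0)))

lemma reflection_defect {C S : Type*} [CommRing C] [Ring S] [Algebra C S]
    (w A₀ A₁ a b a' b' α β γ δ : C) (R K : S) (hR : R * R = w • R + 1)
    (hK : K * K = A₀ • K + A₁ • 1) (hRK : R * K * R * K = K * R * K * R) :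
    (α • R + β • 1) * (a • 1 + b • K) * (γ • R + δ • 1) * (a' • 1 + b' • K) -
        (a' • 1 + b' • K) * (γ • R + δ • 1) * (a • 1 + b • K) * (α • R + β • 1) =
      (a * b' * α * γ * w + α * δ * (a * b' + b * a' + b * b' * A₀) +
        β * γ * (a * b' - b * a')) • (R * K - K * R) := by
  have hRK' : R * (K * (R * K)) = K * (R * (K * R)) := by
    simpa only [mul_assoc] using hRK
  simp only [mul_add, add_mul, smul_mul_assoc, mul_smul_comm, mul_one, one_mul, smul_smul,
    smul_add, mul_assoc, hR, hK, hRK']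
  module

/-- Version of `reflection_defect` for scalars acting through a central ring homomorphism. -/
lemma reflection_defect_of_central {C S : Type*} [CommRing C] [Ring S] (j : C →+* S)
    (hj : ∀ c s, j c * s = s * j c)
    (w A₀ A₁ a b a' b' α β γ δ : C) (R K : S) (hR : R * R = j w * R + 1)
    (hK : K * K = j A₀ * K + j A₁) (hRK : R * K * R * K = K * R * K * R) :
    (j α * R + j β) * (j a + j b * K) * (j γ * R + j δ) * (j a' + j b' * K) -
        (j a' + j b' * K) * (j γ * R + j δ) * (j a + j b * K) * (j α * R + j β) =
      j (a * b' * α * γ * w + α * δ * (a * b' + b * a' + b * b' * A₀) +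
        β * γ * (a * b' - b * a')) * (R * K - K * R) := by
  let := j.toAlgebra' hj
  have hsmul (c : C) (s : S) : c • s = j c * s := rfl
  have h := reflection_defect w A₀ A₁ a b a' b' α β γ δ R K hR
    (by rw [hK, hsmul, hsmul, mul_one]) hRK
  simpa only [hsmul, mul_one] using h

lemma spectral_reflection_iff {C S : Type*} [CommRing C] [Ring S] (j : C →+* S)
    (hj : ∀ c s, j c * s = s * j c)
    (w A₀ A₁ a₀ b₀ a₁ b₁ x x' y y' : C) (R K : S) (hR : R * R = j w * R + 1)
    (hK : K * K = j A₀ * K + j A₁) (hRK : R * K * R * K = K * R * K * R)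
    (hcomm : ∀ s, j s * (R * K - K * R) = 0 → s = 0) (hw : IsUnit w)
    (hx : x * x' = 1) (hy : y * y' = 1) :
    (j (1 - x' * y) * R + j (x' * y * w)) * (j a₀ + j b₀ * K) *
          (j (1 - x' * y') * R + j (x' * y' * w)) * (j a₁ + j b₁ * K) =
        (j a₁ + j b₁ * K) * (j (1 - x' * y') * R + j (x' * y' * w)) *
          (j a₀ + j b₀ * K) * (j (1 - x' * y) * R + j (x' * y * w)) ↔
      ((x - x') * a₀ - x' * A₀ * b₀) * b₁ = b₀ * ((y - y') * a₁ - y' * A₀ * b₁) := by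
  have hs : a₀ * b₁ * (1 - x' * y) * (1 - x' * y') * w +
      (1 - x' * y) * (x' * y' * w) * (a₀ * b₁ + b₀ * a₁ + b₀ * b₁ * A₀) +
      x' * y * w * (1 - x' * y') * (a₀ * b₁ - b₀ * a₁) =
      w * x' * (((x - x') * a₀ - x' * A₀ * b₀) * b₁ - b₀ * ((y - y') * a₁ - y' * A₀ * b₁)) := by
    linear_combination (-w * a₀ * b₁) * hx + (-w * x' ^ 2 * (a₀ * b₁ + b₀ * b₁ * A₀)) * hy
  have hunit : IsUnit (w * x') := hw.mul (IsUnit.of_mul_eq_one x (by rw [mul_comm, hx]))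
  rw [← sub_eq_zero, reflection_defect_of_central j hj w A₀ A₁ _ _ _ _ _ _ _ _ R K hR hK hRK, hs,
    ← sub_eq_zero (b := b₀ * _)]
  constructor
  · intro h
    exact hunit.mul_right_eq_zero.mp (hcomm _ h)
  · intro h
    rw [h, mul_zero, map_zero, zero_mul]

/-- The image of `R` in a two-dimensional representation of the quadratic cyclotomic Hecke algebra
in which `R` and `K` do not commute. -/
def reprR (A₀ A₁ : z) : Matrix (Fin 2) (Fin 2) (QuadraticAlgebra z (1 + A₁) (ω + A₀)) :=
  !![⟨ω, -1⟩, ⟨-A₁, -A₀⟩; 1, ⟨0, 1⟩]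

/-- The image of `K` in the same representation: a companion matrix. -/
def reprK (A₀ A₁ : z) : Matrix (Fin 2) (Fin 2) (QuadraticAlgebra z (1 + A₁) (ω + A₀)) :=
  !![0, ⟨A₁, 0⟩; 1, ⟨A₀, 0⟩]

lemma reprR_mul_self (A₀ A₁ : z) :
    reprR z ω A₀ A₁ * reprR z ω A₀ A₁ = ω • reprR z ω A₀ A₁ + 1 := by
  ext i j <;> fin_cases i <;> fin_cases j <;>
    simp [reprR, Matrix.mul_apply, QuadraticAlgebra.re_one, QuadraticAlgebra.im_one] <;> ring

lemma reprK_mul_self (A₀ A₁ : z) :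
    reprK z ω A₀ A₁ * reprK z ω A₀ A₁ = A₀ • reprK z ω A₀ A₁ + A₁ • 1 := by
  ext i j <;> fin_cases i <;> fin_cases j <;>
    simp [reprK, Matrix.mul_apply, QuadraticAlgebra.re_one, QuadraticAlgebra.im_one] <;> ring

lemma reprR_reprK_reflection (A₀ A₁ : z) :
    reprR z ω A₀ A₁ * reprK z ω A₀ A₁ * reprR z ω A₀ A₁ * reprK z ω A₀ A₁ =
      reprK z ω A₀ A₁ * reprR z ω A₀ A₁ * reprK z ω A₀ A₁ * reprR z ω A₀ A₁ := by
  ext i j <;> fin_cases i <;> fin_cases j <;>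
    simp [reprR, reprK, Matrix.mul_apply] <;> ring

/-- The representation of the affine Hecke algebra given by `reprR` and `reprK`. -/
def HRepr (A₀ A₁ : z) : H z ω →ₐ[z]
    Matrix (Fin 2) (Fin 2) (QuadraticAlgebra z (1 + A₁) (ω + A₀)) :=
  RingQuot.liftAlgHom z
    ⟨FreeAlgebra.lift z (fun g => match g with
      | G.R => reprR z ω A₀ A₁
      | G.K => reprK z ω A₀ A₁), by
      rintro _ _ (_ | _)
      · simpa using reprR_mul_self z ω A₀ A₁
      · simpa using reprR_reprK_reflection z ω A₀ A₁⟩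

lemma HRepr_Rg (A₀ A₁ : z) : HRepr z ω A₀ A₁ (Rg z ω) = reprR z ω A₀ A₁ :=
  (RingQuot.liftAlgHom_mkAlgHom_apply _ _ _ _).trans (by simp)

lemma HRepr_Kg (A₀ A₁ : z) : HRepr z ω A₀ A₁ (Kg z ω) = reprK z ω A₀ A₁ :=
  (RingQuot.liftAlgHom_mkAlgHom_apply _ _ _ _).trans (by simp)

/-- The representation `HRepr` factors through the quadratic cyclotomic Hecke algebra. -/
def HpRepr (A : ℕ → z) : Hp z ω 1 A →ₐ[z]
    Matrix (Fin 2) (Fin 2) (QuadraticAlgebra z (1 + A 1) (ω + A 0)) :=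
  RingQuot.liftAlgHom z ⟨HRepr z ω (A 0) (A 1), by
    rintro _ _ ⟨⟩
    simp [pKelt, Finset.sum_range_succ, HRepr_Kg, pow_two, reprK_mul_self]⟩

lemma HpRepr_Rp (A : ℕ → z) : HpRepr z ω A (Rp z ω 1 A) = reprR z ω (A 0) (A 1) :=
  (RingQuot.liftAlgHom_mkAlgHom_apply _ _ _ _).trans (HRepr_Rg z ω _ _)

lemma HpRepr_Kp (A : ℕ → z) : HpRepr z ω A (Kp z ω 1 A) = reprK z ω (A 0) (A 1) :=
  (RingQuot.liftAlgHom_mkAlgHom_apply _ _ _ _).trans (HRepr_Kg z ω _ _)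

lemma Rp_mul_self (A : ℕ → z) :
    Rp z ω 1 A * Rp z ω 1 A = ω • Rp z ω 1 A + 1 := by
  have h : Rg z ω * Rg z ω = ω • Rg z ω + 1 := by
    have h := RingQuot.mkAlgHom_rel z (HRel.hecke (z := z) (ω := ω))
    rw [map_mul, map_add, map_smul, map_one] at h
    exact h
  have h' := congrArg (RingQuot.mkAlgHom z (CRel z ω 1 A)) h
  rw [map_mul, map_add, map_smul, map_one] at h'
  exact h'

lemma Rp_Kp_reflection (A : ℕ → z) :
    Rp z ω 1 A * Kp z ω 1 A * Rp z ω 1 A * Kp z ω 1 A =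
      Kp z ω 1 A * Rp z ω 1 A * Kp z ω 1 A * Rp z ω 1 A := by
  have h : Rg z ω * Kg z ω * Rg z ω * Kg z ω = Kg z ω * Rg z ω * Kg z ω * Rg z ω := by
    have h := RingQuot.mkAlgHom_rel z (HRel.re (z := z) (ω := ω))
    simp only [map_mul] at h
    exact h
  have h' := congrArg (RingQuot.mkAlgHom z (CRel z ω 1 A)) h
  simp only [map_mul] at h'
  exact h'

lemma Kp_mul_self (A : ℕ → z) :
    Kp z ω 1 A * Kp z ω 1 A = A 0 • Kp z ω 1 A + A 1 • 1 := by
  have h := RingQuot.mkAlgHom_rel z (CRel.mk (z := z) (ω := ω) (n := 1) (A := A))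
  simp only [pKelt, Finset.sum_range_succ, Finset.sum_range_zero, zero_add, map_add, map_neg,
    map_smul, map_pow, map_zero, Nat.sub_zero, pow_one, Nat.sub_self, pow_zero, map_one] at h
  have h' : -(Kp z ω 1 A) ^ 2 + (A 0 • Kp z ω 1 A + A 1 • 1) = 0 := h
  rw [← pow_two]
  exact (neg_add_eq_zero.mp h')

/-- A `z`-linear functional detecting the commutator `[R, K]`. -/
def commFunctional (A : ℕ → z) : Hp z ω 1 A →ₗ[z] z where
  toFun h := (HpRepr z ω A h 1 0).im
  map_add' := by simp
  map_smul' := by simp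

lemma commFunctional_comm (A : ℕ → z) :
    commFunctional z ω A (Rp z ω 1 A * Kp z ω 1 A - Kp z ω 1 A * Rp z ω 1 A) = 2 := by
  simp [commFunctional, HpRepr_Rp, HpRepr_Kp, reprR, reprK]
  norm_num

section Scalars

variable {E : Type} [CommRing E] [Algebra k E]

/-- The map from `z`-valued to `H_p`-valued functions induced by the structure map of `H_p`. -/
def scalarHom (A : ℕ → z) : E ⊗[k] z →ₐ[E] E ⊗[k] Hp z ω 1 A :=
  Algebra.TensorProduct.map (AlgHom.id E E) (IsScalarTower.toAlgHom k z (Hp z ω 1 A))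

lemma scalarHom_tmul (A : ℕ → z) (e : E) (c : z) :
    scalarHom k z ω A (e ⊗ₜ[k] c) = e ⊗ₜ algebraMap z (Hp z ω 1 A) c := rfl

lemma scalarHom_commute (A : ℕ → z) (a : E ⊗[k] z) (s : E ⊗[k] Hp z ω 1 A) :
    scalarHom k z ω A a * s = s * scalarHom k z ω A a := by
  induction a with
  | zero => simp
  | add a b ha hb => rw [map_add, add_mul, mul_add, ha, hb]
  | tmul e c =>
    induction s with
    | zero => simp
    | add a b ha hb => rw [add_mul, mul_add, ha, hb]
    | tmul f h =>
      rw [scalarHom_tmul, Algebra.TensorProduct.tmul_mul_tmul, Algebra.TensorProduct.tmul_mul_tmul,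
        mul_comm e f, Algebra.commutes]

lemma scalarHom_mul_comm_eq_zero [CharZero k] (A : ℕ → z) (s : E ⊗[k] z)
    (hs : scalarHom k z ω A s *
      (1 : E) ⊗ₜ[k] (Rp z ω 1 A * Kp z ω 1 A - Kp z ω 1 A * Rp z ω 1 A) = 0) : s = 0 := by
  have key (t : E ⊗[k] z) :
      ((commFunctional z ω A).restrictScalars k).lTensor E (scalarHom k z ω A t *
        (1 : E) ⊗ₜ[k] (Rp z ω 1 A * Kp z ω 1 A - Kp z ω 1 A * Rp z ω 1 A)) = (2 : k) • t := by
    induction t with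
    | zero => simp
    | add a b ha hb => rw [map_add, add_mul, map_add, ha, hb, smul_add]
    | tmul e c =>
      rw [scalarHom_tmul, Algebra.TensorProduct.tmul_mul_tmul, LinearMap.lTensor_tmul,
        ← Algebra.smul_def, LinearMap.restrictScalars_apply, map_smul, commFunctional_comm,
        ← TensorProduct.tmul_smul, mul_one, smul_eq_mul, ofNat_smul_eq_nsmul, nsmul_eq_mul, mul_comm]
      rfl
  have h := key s
  rw [hs, map_zero] at h
  exact (smul_eq_zero_iff_right (two_ne_zero (α := k))).mp h.symm

end Scalars

lemma iota_scalarHom (A : ℕ → z) (i : Fin 2) (a : RatFunc k ⊗[k] z) :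
    iota k i (scalarHom k z ω A a) = scalarHom k z ω A (iota k i a) := by
  induction a with
  | zero => simp
  | add a b ha hb => simp only [map_add, ha, hb]
  | tmul e c => rfl

lemma RxElt_eq (A : ℕ → z) (v : k) (t : F2 k) :
    RxElt k v (Rp z ω 1 A) t =
      scalarHom k z ω A ((1 - t⁻¹) ⊗ₜ 1) * (1 : F2 k) ⊗ₜ[k] Rp z ω 1 A +
        scalarHom k z ω A (t⁻¹ ⊗ₜ algebraMap k z v) := by
  rw [RxElt, scalarHom_tmul, scalarHom_tmul, map_one, ← IsScalarTower.algebraMap_apply,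
    Algebra.TensorProduct.tmul_mul_tmul, TensorProduct.tmul_sub,
    smul_sub]
  simp only [TensorProduct.smul_tmul', TensorProduct.sub_tmul, smul_eq_mul, mul_one, one_mul]
  abel

lemma RxElt_div (A : ℕ → z) (v : k) (hω : ω = algebraMap k z v) (s t : F2 k) :
    RxElt k v (Rp z ω 1 A) (s / t) =
      scalarHom k z ω A (1 - s⁻¹ ⊗ₜ 1 * t ⊗ₜ 1) * (1 : F2 k) ⊗ₜ[k] Rp z ω 1 A +
        scalarHom k z ω A (s⁻¹ ⊗ₜ 1 * t ⊗ₜ 1 * 1 ⊗ₜ ω) := by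
  rw [RxElt_eq, ← hω, inv_div, div_eq_inv_mul, TensorProduct.sub_tmul,
    Algebra.TensorProduct.tmul_mul_tmul, Algebra.TensorProduct.tmul_mul_tmul, one_mul, one_mul,
    mul_one, Algebra.TensorProduct.one_def]

lemma RxElt_mul (A : ℕ → z) (v : k) (hω : ω = algebraMap k z v) (s t : F2 k) :
    RxElt k v (Rp z ω 1 A) (s * t) =
      scalarHom k z ω A (1 - s⁻¹ ⊗ₜ 1 * t⁻¹ ⊗ₜ 1) * (1 : F2 k) ⊗ₜ[k] Rp z ω 1 A +
        scalarHom k z ω A (s⁻¹ ⊗ₜ 1 * t⁻¹ ⊗ₜ 1 * 1 ⊗ₜ ω) := by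
  rw [RxElt_eq, ← hω, mul_inv, TensorProduct.sub_tmul,
    Algebra.TensorProduct.tmul_mul_tmul, Algebra.TensorProduct.tmul_mul_tmul, one_mul, one_mul,
    mul_one, Algebra.TensorProduct.one_def]

lemma emb_X_zero : emb k 0 RatFunc.X = xvar k := by
  rw [emb, ← RatFunc.algebraMap_X, ← div_one (algebraMap (Polynomial k) (RatFunc k) Polynomial.X),
    ← map_one (algebraMap (Polynomial k) (RatFunc k)), RatFunc.liftAlgHom_apply_div]
  simp [embP, xvar]

lemma emb_X_one : emb k 1 RatFunc.X = yvar k := by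
  rw [emb, ← RatFunc.algebraMap_X, ← div_one (algebraMap (Polynomial k) (RatFunc k) Polynomial.X),
    ← map_one (algebraMap (Polynomial k) (RatFunc k)), RatFunc.liftAlgHom_apply_div]
  simp [embP, yvar]

/-- For `K(x) = a(x) + b(x) K`, the function `(x - x⁻¹) a(x) - x⁻¹ A₀ b(x)`. -/
def numer (A₀ : z) (a b : RatFunc k ⊗[k] z) : RatFunc k ⊗[k] z :=
  ((RatFunc.X - RatFunc.X⁻¹) ⊗ₜ 1) * a - (RatFunc.X⁻¹ ⊗ₜ A₀) * b

lemma iota_tmul {D : Type} [Ring D] [Algebra k D] (i : Fin 2) (f : RatFunc k) (d : D) :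
    iota k i (f ⊗ₜ[k] d) = emb k i f ⊗ₜ d := rfl

lemma iota_zero_numer (A₀ : z) (a b : RatFunc k ⊗[k] z) :
    iota k 0 (numer k z A₀ a b) =
      (xvar k ⊗ₜ 1 - (xvar k)⁻¹ ⊗ₜ 1) * iota k 0 a -
        (xvar k)⁻¹ ⊗ₜ 1 * 1 ⊗ₜ A₀ * iota k 0 b := by
  rw [numer, map_sub, map_mul, map_mul, iota_tmul, iota_tmul, map_sub, map_inv₀, emb_X_zero,
    TensorProduct.sub_tmul, Algebra.TensorProduct.tmul_mul_tmul, one_mul, mul_one]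

lemma iota_one_numer (A₀ : z) (a b : RatFunc k ⊗[k] z) :
    iota k 1 (numer k z A₀ a b) =
      (yvar k ⊗ₜ 1 - (yvar k)⁻¹ ⊗ₜ 1) * iota k 1 a -
        (yvar k)⁻¹ ⊗ₜ 1 * 1 ⊗ₜ A₀ * iota k 1 b := by
  rw [numer, map_sub, map_mul, map_mul, iota_tmul, iota_tmul, map_sub, map_inv₀, emb_X_one,
    TensorProduct.sub_tmul, Algebra.TensorProduct.tmul_mul_tmul, one_mul, mul_one]

lemma isSol_iff [CharZero k] (v : k) (hv : v ≠ 0) (hω : ω = algebraMap k z v) (A : ℕ → z)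
    (a b : RatFunc k ⊗[k] z) :
    IsSol k v (Rp z ω 1 A) (scalarHom k z ω A a + scalarHom k z ω A b * 1 ⊗ₜ Kp z ω 1 A) ↔
      iota k 0 (numer k z (A 0) a b) * iota k 1 b =
        iota k 0 b * iota k 1 (numer k z (A 0) a b) := by
  have hc (c : z) (h : Hp z ω 1 A) : (1 : F2 k) ⊗ₜ[k] (c • h) =
      scalarHom k z ω A (1 ⊗ₜ[k] c) * ((1 : F2 k) ⊗ₜ[k] h) := by
    rw [scalarHom_tmul, Algebra.TensorProduct.tmul_mul_tmul, one_mul, Algebra.smul_def]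
  have hx : xvar k ≠ 0 := by
    rw [← emb_X_zero]; exact (map_ne_zero _).mpr RatFunc.X_ne_zero
  have hy : yvar k ≠ 0 := by
    rw [← emb_X_one]; exact (map_ne_zero _).mpr RatFunc.X_ne_zero
  have hxx : (xvar k ⊗ₜ 1 : F2 k ⊗[k] z) * ((xvar k)⁻¹ ⊗ₜ 1) = 1 := by
    rw [Algebra.TensorProduct.tmul_mul_tmul, mul_inv_cancel₀ hx, one_mul,
      Algebra.TensorProduct.one_def]
  have hyy : (yvar k ⊗ₜ 1 : F2 k ⊗[k] z) * ((yvar k)⁻¹ ⊗ₜ 1) = 1 := by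
    rw [Algebra.TensorProduct.tmul_mul_tmul, mul_inv_cancel₀ hy, one_mul,
      Algebra.TensorProduct.one_def]
  have hw : IsUnit ((1 : F2 k) ⊗ₜ[k] ω) := by
    refine IsUnit.of_mul_eq_one ((1 : F2 k) ⊗ₜ[k] algebraMap k z v⁻¹) ?_
    rw [Algebra.TensorProduct.tmul_mul_tmul, hω, ← map_mul, mul_inv_cancel₀ hv, map_one,
      one_mul, Algebra.TensorProduct.one_def]
  have key := spectral_reflection_iff (scalarHom (E := F2 k) k z ω A).toRingHom
    (scalarHom_commute k z ω A) (1 ⊗ₜ ω) (1 ⊗ₜ A 0) (1 ⊗ₜ A 1)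
    (iota k 0 a) (iota k 0 b) (iota k 1 a) (iota k 1 b)
    (xvar k ⊗ₜ 1) ((xvar k)⁻¹ ⊗ₜ 1) (yvar k ⊗ₜ 1) ((yvar k)⁻¹ ⊗ₜ 1)
    (1 ⊗ₜ Rp z ω 1 A) (1 ⊗ₜ Kp z ω 1 A)
    (by
      rw [Algebra.TensorProduct.tmul_mul_tmul, Rp_mul_self, TensorProduct.tmul_add, one_mul, hc]
      rfl)
    (by
      rw [Algebra.TensorProduct.tmul_mul_tmul, Kp_mul_self, TensorProduct.tmul_add,
        one_mul, hc, hc (A 1)]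
      exact congrArg _ (mul_one _))
    (by simp only [Algebra.TensorProduct.tmul_mul_tmul, Rp_Kp_reflection])
    (fun s hs => scalarHom_mul_comm_eq_zero k z ω A s (by
      rw [Algebra.TensorProduct.tmul_mul_tmul, Algebra.TensorProduct.tmul_mul_tmul, one_mul,
        ← TensorProduct.tmul_sub] at hs
      exact hs))
    hw hxx hyy
  rw [iota_zero_numer, iota_one_numer]
  refine Iff.trans ?_ key
  rw [IsSol, RxElt_div k z ω A v hω, RxElt_mul k z ω A v hω, map_add, map_add, map_mul (iota k 0),
    map_mul (iota k 1), iota_scalarHom, iota_scalarHom, iota_scalarHom, iota_scalarHom, iota_tmul,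
    iota_tmul, map_one, map_one]
  exact Iff.rfl

section Polynomials

variable {E : Type} [CommRing E] [Algebra k E]

/-- Evaluation of a polynomial over `z` at a point of the `k`-algebra `E`. -/
def evalTensor (t : E) : Polynomial z →+* E ⊗[k] z :=
  Polynomial.eval₂RingHom
    (Algebra.TensorProduct.includeRight : z →ₐ[k] E ⊗[k] z).toRingHom (t ⊗ₜ 1)

lemma evalTensor_C (t : E) (c : z) : evalTensor k z t (Polynomial.C c) = 1 ⊗ₜ c := by
  simp [evalTensor]

lemma evalTensor_X (t : E) : evalTensor k z t Polynomial.X = t ⊗ₜ 1 := by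
  simp [evalTensor]

lemma evalTensor_map (p : Polynomial k) :
    evalTensor k z (RatFunc.X : RatFunc k) (p.map (algebraMap k z)) =
      algebraMap (Polynomial k) (RatFunc k) p ⊗ₜ 1 := by
  have h : (evalTensor k z (RatFunc.X : RatFunc k)).comp (Polynomial.mapRingHom (algebraMap k z)) =
      (Algebra.TensorProduct.includeLeft : RatFunc k →ₐ[k] RatFunc k ⊗[k] z).toRingHom.comp
        (algebraMap (Polynomial k) (RatFunc k)) := by
    apply Polynomial.ringHom_ext
    · intro c
      have hc : (1 : RatFunc k) ⊗ₜ[k] algebraMap k z c = RatFunc.C c ⊗ₜ 1 := by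
        rw [Algebra.algebraMap_eq_smul_one, TensorProduct.tmul_smul, TensorProduct.smul_tmul',
          Algebra.smul_def, mul_one]
        rfl
      simpa [evalTensor_C] using hc
    · simp [evalTensor_X]
  exact RingHom.congr_fun h p

lemma iota_evalTensor (i : Fin 2) (p : Polynomial z) :
    iota k i (evalTensor k z RatFunc.X p) = evalTensor k z (emb k i RatFunc.X) p := by
  have h : (iota k i).toRingHom.comp (evalTensor k z RatFunc.X) =
      evalTensor k z (emb k i RatFunc.X) := by
    apply Polynomial.ringHom_ext
    · intro c
      simp [evalTensor_C, iota_tmul]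
    · simp [evalTensor_X, iota_tmul]
  exact RingHom.congr_fun h p

/-- Evaluation of a two-variable polynomial over `z` at the spectral variables. -/
def evalTensor₂ : ZP2 z →+* F2 k ⊗[k] z :=
  MvPolynomial.eval₂Hom (Algebra.TensorProduct.includeRight : z →ₐ[k] F2 k ⊗[k] z).toRingHom
    (fun i => algebraMap (P2 k) (F2 k) (MvPolynomial.X i) ⊗ₜ 1)

lemma evalTensor₂_injective : Function.Injective (evalTensor₂ k z) := by
  let φ : P2 k ⊗[k] z →ₐ[k] F2 k ⊗[k] z :=
    Algebra.TensorProduct.map (IsScalarTower.toAlgHom k (P2 k) (F2 k)) (AlgHom.id k z)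
  have hφ : Function.Injective φ :=
    Module.Flat.rTensor_preserves_injective_linearMap (M := z)
      (IsScalarTower.toAlgHom k (P2 k) (F2 k)).toLinearMap (IsFractionRing.injective (P2 k) (F2 k))
  let e : ZP2 z →+* P2 k ⊗[k] z :=
    (Algebra.TensorProduct.comm k z (P2 k)).toRingEquiv.toRingHom.comp
      (MvPolynomial.algebraTensorAlgEquiv (σ := Fin 2) k z).symm.toRingEquiv.toRingHom
  have he : Function.Injective e :=
    (Algebra.TensorProduct.comm k z (P2 k)).injective.comp
      (MvPolynomial.algebraTensorAlgEquiv (σ := Fin 2) k z).symm.injective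
  have h : evalTensor₂ k z = φ.toRingHom.comp e := by
    apply MvPolynomial.ringHom_ext
    · intro c
      have hc : e (MvPolynomial.C c) = 1 ⊗ₜ c := by
        change Algebra.TensorProduct.comm k z (P2 k)
          ((MvPolynomial.algebraTensorAlgEquiv (σ := Fin 2) k z).symm (MvPolynomial.C c)) = _
        rw [← MvPolynomial.algebraMap_eq, AlgEquiv.commutes]
        rfl
      simp [evalTensor₂, hc, φ]
    · intro i
      have hi : e (MvPolynomial.X i) = MvPolynomial.X i ⊗ₜ 1 := by
        change Algebra.TensorProduct.comm k z (P2 k)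
          ((MvPolynomial.algebraTensorAlgEquiv (σ := Fin 2) k z).symm (MvPolynomial.X i)) = _
        rw [MvPolynomial.algebraTensorAlgEquiv_symm_X]
        rfl
      simp [evalTensor₂, hi, φ]
  rw [h]
  exact hφ.comp he

lemma evalTensor₂_evP (i : Fin 2) (p : Polynomial z) :
    evalTensor₂ k z (evP z i p) =
      evalTensor k z (algebraMap (P2 k) (F2 k) (MvPolynomial.X i)) p := by
  have h : (evalTensor₂ k z).comp (evP z i).toRingHom =
      evalTensor k z (algebraMap (P2 k) (F2 k) (MvPolynomial.X i)) := by
    apply Polynomial.ringHom_ext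
    · intro c
      simp [evalTensor_C, evP, evalTensor₂, MvPolynomial.algebraMap_eq]
    · simp [evalTensor_X, evP, evalTensor₂]
  exact RingHom.congr_fun h p

lemma exists_eq_C_mul_of_evP_mul_eq (hz : IsField z) (P Q : Polynomial z) (hQ : Q ≠ 0)
    (h : evP z 0 P * evP z 1 Q = evP z 0 Q * evP z 1 P) :
    ∃ c : z, P = Polynomial.C c * Q := by
  let θ : ZP2 z →ₐ[z] Polynomial (Polynomial z) :=
    MvPolynomial.aeval ![Polynomial.C Polynomial.X, Polynomial.X]
  have h0 (p : Polynomial z) : θ (evP z 0 p) = Polynomial.C p := by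
    have hh : (θ.comp (evP z 0)).toRingHom = Polynomial.C := by
      apply Polynomial.ringHom_ext
      · intro c
        simp [θ, evP, Polynomial.algebraMap_apply]
      · simp [θ, evP]
    exact RingHom.congr_fun hh p
  have h1 (p : Polynomial z) : θ (evP z 1 p) = p.map Polynomial.C := by
    have hh : (θ.comp (evP z 1)).toRingHom = Polynomial.mapRingHom Polynomial.C := by
      apply Polynomial.ringHom_ext
      · intro c
        simp [θ, evP, Polynomial.algebraMap_apply]
      · simp [θ, evP]
    exact RingHom.congr_fun hh p
  obtain ⟨n, hn⟩ : ∃ n, Q.coeff n ≠ 0 := by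
    by_contra! hcon
    exact hQ (Polynomial.ext hcon)
  obtain ⟨d, hd⟩ := hz.mul_inv_cancel hn
  have h' := congrArg (fun p => (θ p).coeff n) h
  simp only [map_mul, h0, h1, Polynomial.coeff_C_mul, Polynomial.coeff_map] at h'
  refine ⟨d * P.coeff n, ?_⟩
  rw [map_mul]
  have hd' : Polynomial.C (Q.coeff n) * Polynomial.C d = 1 := by rw [← map_mul, hd, map_one]
  linear_combination Polynomial.C d * h' - P * hd'

lemma exists_denominator (a : RatFunc k ⊗[k] z) :
    ∃ D : Polynomial k, D ≠ 0 ∧ ∃ P : Polynomial z,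
      (algebraMap (Polynomial k) (RatFunc k) D ⊗ₜ 1) * a = evalTensor k z RatFunc.X P := by
  induction a with
  | zero => exact ⟨1, one_ne_zero, 0, by simp⟩
  | tmul f c =>
    refine ⟨f.denom, f.denom_ne_zero, f.num.map (algebraMap k z) * Polynomial.C c, ?_⟩
    have hf : algebraMap (Polynomial k) (RatFunc k) f.denom * f =
        algebraMap (Polynomial k) (RatFunc k) f.num := by
      have h0 : algebraMap (Polynomial k) (RatFunc k) f.denom ≠ 0 :=
        RatFunc.algebraMap_ne_zero f.denom_ne_zero
      rw [mul_comm]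
      exact (eq_div_iff h0).mp (RatFunc.num_div_denom f).symm
    rw [map_mul, evalTensor_map, evalTensor_C, Algebra.TensorProduct.tmul_mul_tmul,
      Algebra.TensorProduct.tmul_mul_tmul, hf, mul_one]
  | add a b ha hb =>
    obtain ⟨D₁, hD₁, P₁, h₁⟩ := ha
    obtain ⟨D₂, hD₂, P₂, h₂⟩ := hb
    refine ⟨D₁ * D₂, mul_ne_zero hD₁ hD₂,
      D₂.map (algebraMap k z) * P₁ + D₁.map (algebraMap k z) * P₂, ?_⟩
    have hm : algebraMap (Polynomial k) (RatFunc k) (D₁ * D₂) ⊗ₜ[k] (1 : z) =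
        algebraMap (Polynomial k) (RatFunc k) D₁ ⊗ₜ 1 *
          algebraMap (Polynomial k) (RatFunc k) D₂ ⊗ₜ 1 := by
      rw [Algebra.TensorProduct.tmul_mul_tmul, map_mul, one_mul]
    rw [map_add, map_mul (evalTensor k z RatFunc.X), map_mul (evalTensor k z RatFunc.X),
      evalTensor_map, evalTensor_map, ← h₁, ← h₂, hm]
    ring

lemma exists_eq_tmul_mul_of_iota_mul_eq (hz : IsField z) (g b : RatFunc k ⊗[k] z) (hb : b ≠ 0)
    (h : iota k 0 g * iota k 1 b = iota k 0 b * iota k 1 g) :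
    ∃ c : z, g = (1 ⊗ₜ c) * b := by
  obtain ⟨D₁, hD₁, P₁, h₁⟩ := exists_denominator k z g
  obtain ⟨D₂, hD₂, P₂, h₂⟩ := exists_denominator k z b
  let ψ : RatFunc k →+* RatFunc k ⊗[k] z :=
    (Algebra.TensorProduct.includeLeft : RatFunc k →ₐ[k] RatFunc k ⊗[k] z).toRingHom
  have hunit {D : Polynomial k} (hD : D ≠ 0) :
      IsUnit (algebraMap (Polynomial k) (RatFunc k) D ⊗ₜ[k] (1 : z)) :=
    (IsUnit.mk0 _ (RatFunc.algebraMap_ne_zero hD)).map ψ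
  set d₁ := algebraMap (Polynomial k) (RatFunc k) D₁ ⊗ₜ[k] (1 : z) with hd₁
  set d₂ := algebraMap (Polynomial k) (RatFunc k) D₂ ⊗ₜ[k] (1 : z) with hd₂
  have hP : evalTensor k z RatFunc.X (D₂.map (algebraMap k z) * P₁) = d₁ * d₂ * g := by
    rw [map_mul, evalTensor_map, ← h₁]
    ring
  have hQ : evalTensor k z RatFunc.X (D₁.map (algebraMap k z) * P₂) = d₁ * d₂ * b := by
    rw [map_mul, evalTensor_map, ← h₂]
    ring
  have hu : IsUnit (d₁ * d₂) := (hunit hD₁).mul (hunit hD₂)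
  have hne : D₁.map (algebraMap k z) * P₂ ≠ 0 := by
    intro h0
    rw [h0, map_zero] at hQ
    exact hb (hu.mul_right_eq_zero.mp hQ.symm)
  obtain ⟨c, hc⟩ := exists_eq_C_mul_of_evP_mul_eq z hz (D₂.map (algebraMap k z) * P₁) _ hne (by
    apply evalTensor₂_injective k z
    have hx : algebraMap (P2 k) (F2 k) (MvPolynomial.X 0) = emb k 0 RatFunc.X := (emb_X_zero k).symm
    have hy : algebraMap (P2 k) (F2 k) (MvPolynomial.X 1) = emb k 1 RatFunc.X := (emb_X_one k).symm
    rw [map_mul (evalTensor₂ k z), map_mul (evalTensor₂ k z), evalTensor₂_evP, evalTensor₂_evP,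
      evalTensor₂_evP, evalTensor₂_evP, hx, hy, ← iota_evalTensor, ← iota_evalTensor,
      ← iota_evalTensor, ← iota_evalTensor, hP, hQ]
    simp only [map_mul]
    linear_combination (iota k 0 d₁ * iota k 0 d₂ * iota k 1 d₁ * iota k 1 d₂) * h)
  refine ⟨c, hu.mul_left_cancel ?_⟩
  rw [← hP, hc, map_mul, hQ, evalTensor_C]
  ring

end Polynomials

lemma exists_of_mem_KpX (A : ℕ → z) {c : RatFunc k ⊗[k] Hp z ω 1 A} (hc : c ∈ KpX k z ω 1 A) :
    ∃ a b : RatFunc k ⊗[k] z,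
      c = scalarHom k z ω A a + scalarHom k z ω A b * 1 ⊗ₜ Kp z ω 1 A := by
  induction hc using Algebra.adjoin_induction with
  | mem c hc =>
    rcases hc with rfl | ⟨d, rfl⟩
    · exact ⟨0, 1, by rw [map_zero, map_one, zero_add, one_mul]⟩
    · exact ⟨1 ⊗ₜ d, 0, by rw [map_zero, zero_mul, add_zero, scalarHom_tmul]⟩
  | algebraMap f =>
    exact ⟨algebraMap _ _ f, 0, by rw [map_zero, zero_mul, add_zero, AlgHom.commutes]⟩
  | add c d _ _ hc hd =>
    obtain ⟨a₁, b₁, rfl⟩ := hc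
    obtain ⟨a₂, b₂, rfl⟩ := hd
    refine ⟨a₁ + a₂, b₁ + b₂, ?_⟩
    rw [map_add, map_add, add_mul]
    abel
  | mul c d _ _ hc hd =>
    obtain ⟨a₁, b₁, rfl⟩ := hc
    obtain ⟨a₂, b₂, rfl⟩ := hd
    refine ⟨a₁ * a₂ + b₁ * b₂ * 1 ⊗ₜ A 1, a₁ * b₂ + b₁ * a₂ + b₁ * b₂ * 1 ⊗ₜ A 0, ?_⟩
    set K : RatFunc k ⊗[k] Hp z ω 1 A := 1 ⊗ₜ Kp z ω 1 A with hK
    have hKK : K * K = scalarHom k z ω A (1 ⊗ₜ A 0) * K + scalarHom k z ω A (1 ⊗ₜ A 1) := by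
      rw [hK, Algebra.TensorProduct.tmul_mul_tmul, Kp_mul_self, scalarHom_tmul, scalarHom_tmul,
        Algebra.TensorProduct.tmul_mul_tmul, one_mul, TensorProduct.tmul_add, Algebra.smul_def,
        Algebra.smul_def, mul_one]
    have ha : K * scalarHom k z ω A a₂ = scalarHom k z ω A a₂ * K :=
      (scalarHom_commute k z ω A a₂ K).symm
    have hb : K * scalarHom k z ω A b₂ = scalarHom k z ω A b₂ * K :=
      (scalarHom_commute k z ω A b₂ K).symm
    simp only [map_add, map_mul, add_mul, mul_add, mul_assoc]
    rw [ha, ← mul_assoc K, hb, mul_assoc _ K K, hKK]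
    simp only [mul_add]
    abel

lemma isScalarElt_scalarHom (A : ℕ → z) (a : RatFunc k ⊗[k] z) :
    IsScalarElt k z (scalarHom k z ω A a) := by
  induction a with
  | zero => rw [map_zero]; exact Submodule.zero_mem _
  | add a b ha hb => rw [map_add]; exact Submodule.add_mem _ ha hb
  | tmul f c =>
    have h : scalarHom k z ω A (f ⊗ₜ[k] c) =
        f • ((1 : RatFunc k) ⊗ₜ[k] algebraMap z (Hp z ω 1 A) c) := by
      rw [scalarHom_tmul, TensorProduct.smul_tmul', smul_eq_mul, mul_one]
    rw [h]
    exact Submodule.smul_mem _ _ (Submodule.subset_span ⟨c, rfl⟩)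

/-- The scalar part of `Kquad`. -/
def quadScalar (A₀ zeta xi : z) : RatFunc k ⊗[k] z :=
  ((RatFunc.X - RatFunc.X⁻¹)⁻¹ ⊗ₜ 1) *
    (1 ⊗ₜ zeta - RatFunc.X⁻¹ ⊗ₜ 1 * (RatFunc.X ⊗ₜ xi - 1 ⊗ₜ A₀))

lemma Kquad_eq (A : ℕ → z) (zeta xi : z) :
    Kquad k z ω A zeta xi =
      scalarHom k z ω A (quadScalar k z (A 0) zeta xi) + 1 ⊗ₜ Kp z ω 1 A := by
  have h (f : RatFunc k) (s : RatFunc k ⊗[k] Hp z ω 1 A) :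
      f • s = scalarHom k z ω A (f ⊗ₜ 1) * s := by
    rw [scalarHom_tmul, map_one, Algebra.smul_def]
    rfl
  rw [Kquad, add_comm, h, h, quadScalar]
  simp only [map_mul, map_sub, scalarHom_tmul]

lemma X_sub_inv_ne_zero : (RatFunc.X - RatFunc.X⁻¹ : RatFunc k) ≠ 0 := by
  intro h
  have h2 : (RatFunc.X : RatFunc k) * RatFunc.X = 1 := by
    nth_rewrite 2 [sub_eq_zero.mp h]
    exact mul_inv_cancel₀ RatFunc.X_ne_zero
  have h3 : (Polynomial.X * Polynomial.X : Polynomial k) = 1 := by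
    apply RatFunc.algebraMap_injective k
    rw [map_mul, RatFunc.algebraMap_X, h2, map_one]
  have h4 := congrArg Polynomial.natDegree h3
  simp at h4

lemma X_sub_inv_mul_quadScalar (A₀ zeta xi : z) :
    ((RatFunc.X - RatFunc.X⁻¹ : RatFunc k) ⊗ₜ[k] (1 : z)) * quadScalar k z A₀ zeta xi =
      1 ⊗ₜ (zeta - xi) + RatFunc.X⁻¹ ⊗ₜ A₀ := by
  rw [quadScalar, ← mul_assoc, Algebra.TensorProduct.tmul_mul_tmul,
    mul_inv_cancel₀ (X_sub_inv_ne_zero k), mul_one, ← Algebra.TensorProduct.one_def, one_mul,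
    mul_sub, Algebra.TensorProduct.tmul_mul_tmul, Algebra.TensorProduct.tmul_mul_tmul,
    inv_mul_cancel₀ RatFunc.X_ne_zero, one_mul, one_mul, mul_one, TensorProduct.tmul_sub]
  ring

/-- quadratic case, n = 1, K² = A₀K + A₁: for every ζ, ξ ∈ 𝔷,
K(x) = K + (ζ − x⁻¹(ξx − A₀))/(x − x⁻¹) solves the reflection equation with spectral
parameter, and if 𝔷 is a field every non-trivial solution equals f(x)·K(x) for some
f ∈ 𝔷(x) and some ζ, ξ ∈ 𝔷. -/
theorem baxterization_quadratic [CharZero k]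
    (q : k) (hq0 : q ≠ 0) (hq1 : q ≠ 1) (hq1' : q ≠ -1)
    (hω : ω = algebraMap k z (q - q⁻¹)) (A : ℕ → z) :
    (∀ zeta xi : z, IsSol k (q - q⁻¹) (Rp z ω 1 A) (Kquad k z ω A zeta xi)) ∧
      (IsField z → ∀ c ∈ KpX k z ω 1 A,
        IsSol k (q - q⁻¹) (Rp z ω 1 A) c → ¬ IsScalarElt k z c →
        ∃ f : RatFunc k ⊗[k] Hp z ω 1 A, IsScalarElt k z f ∧
          ∃ zeta xi : z, c = f * Kquad k z ω A zeta xi) := by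
  have hv : q - q⁻¹ ≠ 0 := by
    intro h
    have h2 : q * q = 1 := by
      nth_rewrite 2 [sub_eq_zero.mp h]
      exact mul_inv_cancel₀ hq0
    rcases mul_self_eq_one_iff.mp h2 with h3 | h3
    · exact hq1 h3
    · exact hq1' h3
  refine ⟨fun zeta xi => ?_, fun hz c hc hsol hns => ?_⟩
  · have hn : numer k z (A 0) (quadScalar k z (A 0) zeta xi) 1 = 1 ⊗ₜ (zeta - xi) := by
      rw [numer, X_sub_inv_mul_quadScalar, mul_one, add_sub_cancel_right]
    have h := isSol_iff k z ω (q - q⁻¹) hv hω A (quadScalar k z (A 0) zeta xi) 1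
    rw [map_one, one_mul, ← Kquad_eq] at h
    rw [h, hn, map_one, map_one, mul_one, one_mul, iota_tmul, iota_tmul, map_one, map_one]
  · obtain ⟨a, b, rfl⟩ := exists_of_mem_KpX k z ω A hc
    have hb : b ≠ 0 := by
      rintro rfl
      rw [map_zero, zero_mul, add_zero] at hns
      exact hns (isScalarElt_scalarHom k z ω A a)
    rw [isSol_iff k z ω (q - q⁻¹) hv hω] at hsol
    obtain ⟨zeta, hzeta⟩ := exists_eq_tmul_mul_of_iota_mul_eq k z hz _ b hb hsol
    refine ⟨scalarHom k z ω A b, isScalarElt_scalarHom k z ω A b, zeta, 0, ?_⟩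
    rw [Kquad_eq, mul_add, ← map_mul]
    congr 2
    have hu : IsUnit ((RatFunc.X - RatFunc.X⁻¹ : RatFunc k) ⊗ₜ[k] (1 : z)) :=
      (IsUnit.mk0 _ (X_sub_inv_ne_zero k)).map
        (Algebra.TensorProduct.includeLeft : RatFunc k →ₐ[k] RatFunc k ⊗[k] z)
    apply hu.mul_left_cancel
    have h := X_sub_inv_mul_quadScalar k z (A 0) zeta 0
    rw [sub_zero] at h
    rw [numer] at hzeta
    linear_combination hzeta - b * h

end Baxterization
end
end
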